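/- For every integer l ≥ 0 the function f_l is an eigenfunction of the mutated Macdonald operator: for all integers n ≥ 0 one has (t q^n + t^{−1} q^{−n}) · f_l(n) − q^{−n−2} t · f_l(n+2) = (t q^l + t^{−1} q^{−l}) · f_l(n). -/

import Mathlib

/-!
STATEMENT 10: For every integer `l ≥ 0` the function `f_l` is an eigenfunction of the
mutated Macdonald operator: for all integers `n ≥ 0`,
`(t q^n + t⁻¹ q^{−n})·f_l(n) − q^{−n−2} t·f_l(n+2) = (t q^l + t⁻¹ q^{−l})·f_l(n)`.

We realize `ℚ(q,t)` as `RatFunc (RatFunc ℚ)` (inner variable `q`, outer variable `t`).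
Here `f_l(n) = 0` unless `0 ≤ n ≤ l` and `l − n ∈ 2ℤ`, and otherwise
`f_l(n) = (q²;q²)_l (q t⁻¹)^{n−l} / [(t²q^{n+l};q²)_{(l−n)/2} (q^{n−l};q²)_{(l−n)/2}]`.
-/

noncomputable section

/-- The field `ℚ(q,t)`. -/
abbrev K : Type := RatFunc (RatFunc ℚ)

/-- The element `q`. -/
def q : K := RatFunc.C RatFunc.X

/-- The element `t`. -/
def t : K := RatFunc.X

/-- The q-Pochhammer symbol `(a;q²)_m = ∏_{k=0}^{m-1} (1 - (q²)^k a)`. -/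
def poch (a : K) (m : ℕ) : K := ∏ k ∈ Finset.range m, (1 - (q ^ 2) ^ k * a)

/-- The eigenfunction `f_l`. -/
def f (l : ℕ) (n : ℤ) : K :=
  if 0 ≤ n ∧ n ≤ (l : ℤ) ∧ ((l : ℤ) - n) % 2 = 0 then
    poch (q ^ 2) l * (q * t⁻¹) ^ (n - (l : ℤ)) /
      (poch (t ^ 2 * q ^ (n + (l : ℤ))) (((l : ℤ) - n).toNat / 2)
        * poch (q ^ (n - (l : ℤ))) (((l : ℤ) - n).toNat / 2))
  else 0

lemma q_ne : q ≠ 0 := by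
  simp [q, RatFunc.X_ne_zero]

lemma t_ne : t ≠ 0 := RatFunc.X_ne_zero

lemma q_pow_ne (N : ℕ) (hN : N ≠ 0) : q ^ N ≠ 1 := by
  intro h
  have h1 : (RatFunc.X : RatFunc ℚ) ^ N = 1 := by
    apply RatFunc.C_injective
    simpa [q] using h
  have h2 : (Polynomial.X : Polynomial ℚ) ^ N = 1 := by
    apply RatFunc.algebraMap_injective ℚ
    simpa using h1
  have h3 := congrArg (Polynomial.eval 0) h2
  simp [hN] at h3

lemma tq_ne (N : ℕ) : t ^ 2 * q ^ N ≠ 1 := by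
  intro h
  have h2 : (Polynomial.X : Polynomial (RatFunc ℚ)) ^ 2 * Polynomial.C (RatFunc.X ^ N) = 1 := by
    apply RatFunc.algebraMap_injective (RatFunc ℚ)
    simpa [q, t, RatFunc.algebraMap_C] using h
  have h3 := congrArg (Polynomial.eval 0) h2
  simp at h3

lemma poch_succ (a : K) (m : ℕ) : poch a (m + 1) = (1 - a) * poch (q ^ 2 * a) m := by
  unfold poch
  rw [Finset.prod_range_succ', mul_comm]
  congr 1
  · simp
  · apply Finset.prod_congr rfl
    intro k _
    ring

lemma f_step (n m : ℕ) :
    f (n + 2 * (m + 1)) ((n : ℤ) + 2) = f (n + 2 * (m + 1)) n *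
      ((q * t⁻¹) ^ 2 * ((1 - t ^ 2 * q ^ (2 * n + 2 * (m + 1))) *
        (1 - (q ^ (2 * (m + 1)))⁻¹))) := by
  have hq := q_ne
  have ht := t_ne
  have hu : 1 - t ^ 2 * q ^ (2 * n + 2 * (m + 1)) ≠ 0 :=
    sub_ne_zero.2 (tq_ne _).symm
  have hv : 1 - (q ^ (2 * (m + 1)))⁻¹ ≠ 0 := by
    apply sub_ne_zero.2
    intro h
    exact q_pow_ne (2 * (m + 1)) (by omega) (by rw [← inv_inv (q ^ _), ← h, inv_one])
  unfold f
  rw [if_pos (by push_cast; omega), if_pos (by push_cast; omega)]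
  have e1 : (((n + 2 * (m + 1) : ℕ) : ℤ) - ((n : ℤ) + 2)).toNat / 2 = m := by omega
  have e2 : (((n + 2 * (m + 1) : ℕ) : ℤ) - (n : ℤ)).toNat / 2 = m + 1 := by omega
  have e3 : (n : ℤ) + ((n + 2 * (m + 1) : ℕ) : ℤ) = ((2 * n + 2 * (m + 1) : ℕ) : ℤ) := by
    push_cast; ring
  have e4 : (n : ℤ) - ((n + 2 * (m + 1) : ℕ) : ℤ) = -((2 * (m + 1) : ℕ) : ℤ) := by
    push_cast; ring
  have e5 : (n : ℤ) + 2 + ((n + 2 * (m + 1) : ℕ) : ℤ) = 2 + ((2 * n + 2 * (m + 1) : ℕ) : ℤ) := by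
    push_cast; ring
  have e6 : (n : ℤ) + 2 - ((n + 2 * (m + 1) : ℕ) : ℤ) = 2 + -((2 * (m + 1) : ℕ) : ℤ) := by
    push_cast; ring
  have hqt : q * t⁻¹ ≠ 0 := mul_ne_zero hq (inv_ne_zero ht)
  have z2 : ∀ x : K, x ^ (2 : ℤ) = x ^ 2 := fun x => zpow_ofNat x 2
  rw [e1, e2, e3, e4, e5, e6, poch_succ, poch_succ, zpow_add₀ hq, zpow_add₀ hq, zpow_add₀ hqt,
    z2, z2, zpow_natCast, zpow_neg q, zpow_natCast,
    mul_left_comm (t ^ 2) (q ^ 2)]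
  generalize (q * t⁻¹) ^ (-((2 * (m + 1) : ℕ) : ℤ)) = Z
  generalize 1 - t ^ 2 * q ^ (2 * n + 2 * (m + 1)) = u at *
  generalize poch (q ^ 2 * (t ^ 2 * q ^ (2 * n + 2 * (m + 1)))) m = P
  generalize poch (q ^ 2 * (q ^ (2 * (m + 1)))⁻¹) m = Q
  generalize 1 - (q ^ (2 * (m + 1)))⁻¹ = v at *
  generalize poch (q ^ 2) (n + 2 * (m + 1)) = A
  generalize (q * t⁻¹) ^ 2 = B
  rw [show u * P * (v * Q) = (u * v) * (P * Q) by ring, div_mul_eq_mul_div,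
    show A * Z * (B * (u * v)) = (u * v) * (A * (B * Z)) by ring,
    mul_div_mul_left _ _ (mul_ne_zero hu hv)]

/-- The eigenfunction equation for the mutated Macdonald operator
`η_{−1}(M) = t⁻¹U⁻¹ + tU − tV⁻²U⁻¹`. -/
theorem mutated_macdonald_eigenfunction (l : ℕ) (n : ℤ) (hn : 0 ≤ n) :
    (t * q ^ n + t⁻¹ * q ^ (-n)) * f l n - q ^ (-n - 2) * t * f l (n + 2)
      = (t * q ^ (l : ℤ) + t⁻¹ * q ^ (-(l : ℤ))) * f l n := by
  have hq := q_ne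
  have ht := t_ne
  by_cases h : n ≤ (l : ℤ) ∧ ((l : ℤ) - n) % 2 = 0
  · obtain ⟨h1, h2⟩ := h
    lift n to ℕ using hn
    rcases h1.eq_or_lt with h3 | h3
    · rw [h3, show f l ((l : ℤ) + 2) = 0 from if_neg (by omega)]
      ring
    · obtain ⟨m, rfl⟩ : ∃ m, l = n + 2 * (m + 1) := ⟨(l - n) / 2 - 1, by omega⟩
      rw [f_step]
      generalize f _ _ = F
      rw [show -(n : ℤ) - 2 = -((n + 2 : ℕ) : ℤ) by push_cast; ring]
      simp only [zpow_neg, zpow_natCast]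
      field_simp
      ring
  · rw [show f l n = 0 from if_neg (by omega), show f l (n + 2) = 0 from if_neg (by omega)]
    simp

end
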